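/- arXiv:1907.06152 — 2 statements merged into one kernel-verified Lean document; each statement's English description precedes it below -/
import Mathlib

section
/- For (φ,ρ) ∈ ℂ^5 × ℂ, the cosection linear functional σ_{(φ,ρ)} : ℂ^5 × ℂ → ℂ is the zero linear map if and only if either φ = 0, or else ρ = 0 and φ_1^5 + ⋯ + φ_5^5 = 0. (This is the pointwise description of the degeneracy locus of the MSP cosection: the curve decomposes into the part where φ vanishes and the part where ρ = 0 and Σφ_i^5 = 0.) -/
/-- The cosection linear functional
`σ_{(φ,ρ)}(φ̇,ρ̇) = ρ̇·Σ φᵢ^5 + 5ρ·Σ φᵢ^4 φ̇ᵢ`, the supersymmetry variation of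
the superpotential `ρ·(φ₁^5 + ⋯ + φ₅^5)`. -/
noncomputable def cosection (φ : Fin 5 → ℂ) (ρ : ℂ) (φ' : Fin 5 → ℂ) (ρ' : ℂ) : ℂ :=
  ρ' * (∑ i, φ i ^ 5) + 5 * ρ * (∑ i, φ i ^ 4 * φ' i)

/-- Pointwise description of the degeneracy locus of the MSP cosection:
`σ_{(φ,ρ)}` is the zero linear map iff `φ = 0`, or else `ρ = 0` and
`φ₁^5 + ⋯ + φ₅^5 = 0`. -/
theorem cosection_degeneracy_locus (φ : Fin 5 → ℂ) (ρ : ℂ) :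
    (∀ (φ' : Fin 5 → ℂ) (ρ' : ℂ), cosection φ ρ φ' ρ' = 0) ↔
      (φ = 0 ∨ (ρ = 0 ∧ ∑ i, φ i ^ 5 = 0)) := by
  constructor
  · intro h
    have hsum : ∑ i, φ i ^ 5 = 0 := by simpa [cosection] using h 0 1
    by_cases hρ : ρ = 0
    · exact Or.inr ⟨hρ, hsum⟩
    · left
      funext j
      simpa [cosection, Pi.single_apply, hρ] using h (Pi.single j 1) 0
  · rintro (rfl | ⟨rfl, hsum⟩) φ' ρ'
    · simp [cosection]
    · simp [cosection, hsum]
end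

section
/- Fixed-point trichotomy for the master space: let (x,p,u) ∈ ℂ^5 × ℂ × (ℂ^2 ∖ {0}), with u = (u_1,u_2), satisfy the stability conditions (x,u_1) ≠ (0,0) and (p,u_2) ≠ (0,0). Then the following are equivalent: (a) for every t ∈ ℂ* there exist s, λ ∈ ℂ* such that s·x = x, s^{−5} p = p, s·t·u_1 = λ·u_1 and u_2 = λ·u_2; (b) u_1 = 0, or u_2 = 0, or (x = 0 and p = 0). (This is the statement that the T-fixed locus of the master space W is the disjoint union of the three components K_{P^4} × {0}, the single point {x = p = 0}, and [ℂ^5/ℤ_5] × {∞}.) -/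
/-- Fixed-point trichotomy for the master space `W`: a stable point
`(x, p, [u₁, u₂])` of the master space is fixed by the extra torus
`T`-action `t·(x,p,[u₁,u₂]) = (x,p,[tu₁,u₂])` — i.e. for every `t ∈ ℂ*` the
`T`-translate lies in the same orbit under the gauge `ℂ*`-action
`s·(x,p,u₁,u₂) = (sx, s⁻⁵p, su₁, u₂)` combined with projective rescaling `λ` of
`(u₁,u₂)` — if and only if `u₁ = 0`, or `u₂ = 0`, or `x = 0 ∧ p = 0`.
Hence the `T`-fixed locus of `W` is the disjoint union of `K_{P⁴} × {0}`, the
single point `{x = p = 0}`, and `[ℂ^5/ℤ₅] × {∞}`. -/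
theorem master_space_T_fixed_trichotomy (x : Fin 5 → ℂ) (p u₁ u₂ : ℂ)
    (hu : ¬(u₁ = 0 ∧ u₂ = 0))
    (hstab1 : ¬(x = 0 ∧ u₁ = 0)) (hstab2 : ¬(p = 0 ∧ u₂ = 0)) :
    (∀ t : ℂ, t ≠ 0 → ∃ s l : ℂ, s ≠ 0 ∧ l ≠ 0 ∧
        (fun i => s * x i) = x ∧ s⁻¹ ^ 5 * p = p ∧
        s * t * u₁ = l * u₁ ∧ u₂ = l * u₂) ↔
      (u₁ = 0 ∨ u₂ = 0 ∨ (x = 0 ∧ p = 0)) := by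
  constructor
  · intro h
    by_contra! hne
    obtain ⟨h₁, h₂, hxp⟩ := hne
    obtain ⟨s, l, -, -, hx, hp, hu₁, hu₂⟩ := h 2 two_ne_zero
    obtain rfl : l = 1 := mul_right_cancel₀ h₂ (by rw [← hu₂, one_mul])
    obtain rfl : s = 2⁻¹ := eq_inv_of_mul_eq_one_left (mul_right_cancel₀ h₁ hu₁)
    refine hxp (funext fun i => ?_) ?_
    · have hi : 2⁻¹ * x i = x i := congrFun hx i
      simp only [Pi.zero_apply]
      linear_combination -2 * hi
    · rw [inv_inv] at hp
      linear_combination (1 / 31) * hp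
  · rintro (rfl | rfl | ⟨rfl, rfl⟩) t ht
    · exact ⟨1, 1, one_ne_zero, one_ne_zero, by simp⟩
    · exact ⟨1, t, one_ne_zero, ht, by simp⟩
    · refine ⟨t⁻¹, 1, inv_ne_zero ht, one_ne_zero, ?_, by simp, by simp [ht], by simp⟩
      ext i
      simp
end
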